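/- Let R be a commutative ring, a : Fin d → MvPolynomial (Fin d) R an update with induced map α, η an R-algebra automorphism of MvPolynomial (Fin d) R, α' the map induced by Tr_η(a), and F ⊆ (Fin d → R). Then: (1) η̂ is a bijection of (Fin d → R) with inverse (η⁻¹)-hat; (2) for every c ∈ F, c is a witness for non-termination of the loop (S, a) (i.e., α^[n](c) ∈ S for all n) if and only if η̂(c) is a witness for non-termination of the loop (η̂ '' S, Tr_η(a)) (i.e., α'^[n](η̂(c)) ∈ η̂ '' S for all n); (3) hence there exists c ∈ F with α^[n](c) ∈ S for all n ∈ ℕ if and only if there exists c' ∈ η̂ '' F with α'^[n](c') ∈ η̂ '' S for all n ∈ ℕ, i.e., the loop (S, a) terminates on F iff the transformed loop (η̂ '' S, Tr_η(a)) terminates on η̂ '' F. -/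

import Mathlib

open MvPolynomial

/-- The transformed update `Tr_η(a) i = η⁻¹((aeval a)(η (X i)))`. -/
noncomputable def Tr {R : Type*} [CommRing R] {d : ℕ}
    (η : MvPolynomial (Fin d) R ≃ₐ[R] MvPolynomial (Fin d) R)
    (a : Fin d → MvPolynomial (Fin d) R) (i : Fin d) : MvPolynomial (Fin d) R :=
  η.symm (aeval a (η (X i)))

/-- The induced point map `η̂(c) i = eval c (η (X i))`. -/
noncomputable def hatMap {R : Type*} [CommRing R] {d : ℕ}
    (η : MvPolynomial (Fin d) R ≃ₐ[R] MvPolynomial (Fin d) R)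
    (c : Fin d → R) (i : Fin d) : R :=
  eval c (η (X i))

/-- The map on points induced by an update: `α(c) i = eval c (a i)`. -/
noncomputable def updMap {R : Type*} [CommRing R] {d : ℕ}
    (a : Fin d → MvPolynomial (Fin d) R) (c : Fin d → R) (i : Fin d) : R :=
  eval c (a i)

theorem eval_hatMap_aux {R : Type*} [CommRing R] {d : ℕ}
    (η : MvPolynomial (Fin d) R ≃ₐ[R] MvPolynomial (Fin d) R)
    (c : Fin d → R) (p : MvPolynomial (Fin d) R) :
    eval (hatMap η c) p = eval c (η p) := by
  have h : (aeval (hatMap η c) : MvPolynomial (Fin d) R →ₐ[R] R)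
      = (aeval c).comp η.toAlgHom := by
    apply MvPolynomial.algHom_ext
    intro i
    simp [hatMap, aeval_eq_eval]
  have := DFunLike.congr_fun h p
  simpa [aeval_eq_eval] using this

theorem eval_updMap_aux {R : Type*} [CommRing R] {d : ℕ}
    (a : Fin d → MvPolynomial (Fin d) R)
    (c : Fin d → R) (p : MvPolynomial (Fin d) R) :
    eval (updMap a c) p = eval c (aeval a p) := by
  have h : (aeval (updMap a c) : MvPolynomial (Fin d) R →ₐ[R] R)
      = (aeval c).comp (aeval a) := by
    apply MvPolynomial.algHom_ext
    intro i
    simp [updMap, aeval_eq_eval]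
  have := DFunLike.congr_fun h p
  simpa [aeval_eq_eval] using this

/-- `Tr` preserves (non-)termination: `η̂` is a bijection with inverse `(η⁻¹)-hat`;
`c ∈ F` witnesses non-termination of `(S, a)` iff `η̂(c)` witnesses non-termination of
`(η̂ '' S, Tr_η(a))`; hence `(S, a)` is non-terminating on `F` iff the transformed loop
is non-terminating on `η̂ '' F` (equivalently, `(S, a)` terminates on `F` iff the
transformed loop terminates on `η̂ '' F`). -/
theorem Tr_preserves_termination {R : Type*} [CommRing R] {d : ℕ} (hd : 1 ≤ d)
    (a : Fin d → MvPolynomial (Fin d) R)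
    (η : MvPolynomial (Fin d) R ≃ₐ[R] MvPolynomial (Fin d) R)
    (S F : Set (Fin d → R)) :
    Function.Bijective (hatMap η) ∧
    hatMap η ∘ hatMap η.symm = id ∧
    hatMap η.symm ∘ hatMap η = id ∧
    (∀ c ∈ F, (∀ n : ℕ, (updMap a)^[n] c ∈ S) ↔
      (∀ n : ℕ, (updMap (Tr η a))^[n] (hatMap η c) ∈ hatMap η '' S)) ∧
    ((∃ c ∈ F, ∀ n : ℕ, (updMap a)^[n] c ∈ S) ↔
      (∃ c' ∈ hatMap η '' F, ∀ n : ℕ, (updMap (Tr η a))^[n] c' ∈ hatMap η '' S)) := by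
  have h1 : ∀ c, hatMap η (hatMap η.symm c) = c := by
    intro c
    funext i
    change eval (hatMap η.symm c) (η (X i)) = c i
    rw [eval_hatMap_aux, AlgEquiv.symm_apply_apply, eval_X]
  have h2 : ∀ c, hatMap η.symm (hatMap η c) = c := by
    intro c
    funext i
    change eval (hatMap η c) (η.symm (X i)) = c i
    rw [eval_hatMap_aux, AlgEquiv.apply_symm_apply, eval_X]
  have hinj : Function.Injective (hatMap η) := Function.LeftInverse.injective h2
  have hs : Function.Semiconj (hatMap η) (updMap a) (updMap (Tr η a)) := by
    intro c
    funext i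
    change eval (updMap a c) (η (X i)) = eval (hatMap η c) (η.symm (aeval a (η (X i))))
    rw [eval_hatMap_aux, AlgEquiv.apply_symm_apply, eval_updMap_aux]
  have key : ∀ c, (∀ n : ℕ, (updMap a)^[n] c ∈ S) ↔
      (∀ n : ℕ, (updMap (Tr η a))^[n] (hatMap η c) ∈ hatMap η '' S) := by
    intro c
    refine forall_congr' fun n => ?_
    rw [← (hs.iterate_right n) c, hinj.mem_set_image]
  refine ⟨⟨hinj, Function.RightInverse.surjective h1⟩, funext h1, funext h2,
    fun c _ => key c, ?_⟩
  rw [Set.exists_mem_image]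
  exact exists_congr fun c => and_congr_right fun _ => key c
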